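/- Let A : H → H be a bounded linear operator with ‖I − A‖ < 1 (so A is invertible). Then there exists an integer N such that for every n ≥ N and every y ∈ H, the equation P_n A P_n x = P_n y has a unique solution x_n ∈ H_n, and x_n converges to A^{−1} y in H as n → ∞. -/

import Mathlib

open Filter

/-- The affine equation `T x + b = x` has exactly one solution when `‖T‖ < 1`. -/
theorem ContinuousLinearMap.existsUnique_apply_add_eq_self {𝕜 E : Type*}
    [NontriviallyNormedField 𝕜] [NormedAddCommGroup E] [NormedSpace 𝕜 E] [CompleteSpace E]
    (T : E →L[𝕜] E) (hT : ‖T‖ < 1) (b : E) : ∃! x, T x + b = x := by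
  have hc : ContractingWith ‖T‖₊ fun x => T x + b :=
    ⟨by exact_mod_cast hT, LipschitzWith.of_dist_le_mul fun x y => by
      simpa [dist_eq_norm, ← map_sub] using T.le_opNorm (x - y)⟩
  exact ⟨hc.fixedPoint, hc.fixedPoint_isFixedPt, fun x hx => hc.fixedPoint_unique hx⟩

/-- Finite section method. If H is a separable complex Hilbert space,
(H_n) an increasing sequence of finite-dimensional subspaces with dense union, P_n the
orthogonal projection onto H_n, and A a bounded operator with ‖I − A‖ < 1 (so A is
invertible), then there is N such that for every n ≥ N and y ∈ H the equation
P_n A P_n x = P_n y has a unique solution x_n ∈ H_n, and x_n → A⁻¹y. -/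
theorem finite_section_method
    {H : Type*} [NormedAddCommGroup H] [InnerProductSpace ℂ H] [CompleteSpace H]
    [TopologicalSpace.SeparableSpace H]
    (Hn : ℕ → Submodule ℂ H)
    (hfin : ∀ n, FiniteDimensional ℂ (Hn n))
    (hmono : Monotone Hn)
    (hdense : Dense (⋃ n, (Hn n : Set H)))
    (P : ℕ → H →L[ℂ] H)
    (hPmem : ∀ n, ∀ x : H, P n x ∈ Hn n)
    (hPid : ∀ n, ∀ x ∈ Hn n, P n x = x)
    (hPorth : ∀ n, ∀ x : H, x - P n x ∈ (Hn n)ᗮ)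
    (A : H →L[ℂ] H)
    (hA : ‖ContinuousLinearMap.id ℂ H - A‖ < 1) :
    ∃ N : ℕ, ∀ y : H,
      (∀ n : ℕ, N ≤ n → ∃! x : H, x ∈ Hn n ∧ P n (A x) = P n y) ∧
      (∀ xs : ℕ → H, (∀ n : ℕ, N ≤ n → xs n ∈ Hn n ∧ P n (A (xs n)) = P n y) →
        ∃ z : H, A z = y ∧ Tendsto xs atTop (nhds z)) := by
  have hP : ∀ n, P n = (Hn n).starProjection := fun n => by
    ext x
    exact Submodule.eq_starProjection_of_mem_orthogonal (hPmem n x) (hPorth n x) |>.symm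
  have hP1 : ∀ n, ‖P n‖ ≤ 1 := fun n => hP n ▸ (Hn n).starProjection_norm_le
  set K := ContinuousLinearMap.id ℂ H - A with hK
  have hAK : ∀ x, A x = x - K x := fun x => by simp [hK]
  have hPK : ∀ n, ‖(P n).comp K‖ ≤ ‖K‖ := fun n =>
    ((P n).opNorm_comp_le K).trans (mul_le_of_le_one_left (norm_nonneg _) (hP1 n))
  have hsection : ∀ n x y, x ∈ Hn n → (P n (A x) = P n y ↔ (P n).comp K x + P n y = x) := by
    intro n x y hx
    rw [hAK, map_sub, hPid n x hx, ContinuousLinearMap.comp_apply, sub_eq_iff_eq_add',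
      eq_comm]
  refine ⟨0, fun y => ⟨fun n _ => ?_, fun xs hxs => ?_⟩⟩
  · obtain ⟨x, hx, hu⟩ :=
      ((P n).comp K).existsUnique_apply_add_eq_self ((hPK n).trans_lt hA) (P n y)
    have hmem : x ∈ Hn n := hx ▸ (Hn n).add_mem (hPmem n _) (hPmem n _)
    exact ⟨x, ⟨hmem, (hsection n x y hmem).2 hx⟩,
      fun x' hx' => hu x' ((hsection n x' y hx'.1).1 hx'.2)⟩
  · obtain ⟨z, hz, -⟩ := K.existsUnique_apply_add_eq_self hA y
    refine ⟨z, by rw [hAK, sub_eq_iff_eq_add', hz], ?_⟩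
    have hPz : Tendsto (fun n => P n z) atTop (nhds z) := by
      simp only [hP]
      refine Submodule.starProjection_tendsto_self Hn hmono z ?_
      rw [top_le_iff, ← Submodule.dense_iff_topologicalClosure_eq_top]
      refine hdense.mono (Set.iUnion_subset fun n => ?_)
      exact le_iSup Hn n
    have hbound : ∀ n, ‖xs n - z‖ ≤ (1 - ‖K‖)⁻¹ * ‖P n z - z‖ := by
      intro n
      obtain ⟨hmem, hsol⟩ := hxs n n.zero_le
      have hx := (hsection n _ y hmem).1 hsol
      have heq : xs n - z = (P n).comp K (xs n - z) + (P n z - z) := by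
        nth_rewrite 1 [← hx]
        nth_rewrite 3 [← hz]
        simp only [map_sub, map_add, ContinuousLinearMap.comp_apply]
        abel
      have hle : ‖xs n - z‖ ≤ ‖K‖ * ‖xs n - z‖ + ‖P n z - z‖ :=
        calc ‖xs n - z‖ = ‖(P n).comp K (xs n - z) + (P n z - z)‖ := congrArg norm heq
          _ ≤ _ := (norm_add_le _ _).trans
            (by gcongr; exact ((P n).comp K).le_of_opNorm_le (hPK n) _)
      rw [inv_mul_eq_div, le_div_iff₀ (sub_pos.2 hA)]
      linarith
    rw [tendsto_iff_norm_sub_tendsto_zero] at hPz ⊢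
    exact squeeze_zero (fun _ => norm_nonneg _) hbound (by simpa using hPz.const_mul (1 - ‖K‖)⁻¹)
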